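/- Let p be a prime and let n ≥ 1 and t ≥ 1 be integers. Let u ∈ GL_{2n}(ℤ_p) be the block matrix [[1_n, 0],[w_n, 1_n]]. Then for A, B ∈ GL_n(ℤ_p), the matrix u^{-1}·diag(A,B)·u is upper triangular mod p^t if and only if there exist units y_1, …, y_n ∈ ℤ_p^× such that A ≡ diag(y_1, …, y_n) mod p^t and B ≡ diag(y_n, …, y_1) mod p^t. -/

import Mathlib

/- We index `2n × 2n` matrices by `Fin n ⊕ Fin n` (two blocks of size `n`), with
`ordIdx` giving the usual linear ordering of the `2n` coordinates. -/

/-- The position of an index of `Fin n ⊕ Fin n` in the usual ordering `0, …, 2n−1`. -/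
def ordIdx (n : ℕ) : Fin n ⊕ Fin n → ℕ :=
  Sum.elim (fun a => (a : ℕ)) (fun a => n + (a : ℕ))

/-- The `n × n` antidiagonal matrix `w_n` (0-based: `w i j = 1` iff `i + j + 1 = n`). -/
noncomputable def wMat (p n : ℕ) [Fact p.Prime] : Matrix (Fin n) (Fin n) ℤ_[p] :=
  fun i j => if (i : ℕ) + (j : ℕ) + 1 = n then 1 else 0

/-- The element `u = [[1_n, 0], [w_n, 1_n]] ∈ GL_{2n}(ℤ_p)`. -/
noncomputable def uMat (p n : ℕ) [Fact p.Prime] :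
    Matrix (Fin n ⊕ Fin n) (Fin n ⊕ Fin n) ℤ_[p] :=
  Matrix.fromBlocks 1 0 (wMat p n) 1

/-- The block diagonal matrix `diag(A, B)`. -/
noncomputable def blockDiag (p n : ℕ) [Fact p.Prime] (A B : Matrix (Fin n) (Fin n) ℤ_[p]) :
    Matrix (Fin n ⊕ Fin n) (Fin n ⊕ Fin n) ℤ_[p] :=
  Matrix.fromBlocks A 0 0 B

theorem wMat_apply_rev (p n : ℕ) [Fact p.Prime] (i j : Fin n) :
    wMat p n i j = if j = i.rev then 1 else 0 := by
  unfold wMat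
  congr 1
  rw [Fin.ext_iff, Fin.val_rev]
  apply propext
  omega

theorem conj_eq (p n : ℕ) [Fact p.Prime] (A B : Matrix (Fin n) (Fin n) ℤ_[p]) :
    (uMat p n)⁻¹ * blockDiag p n A B * uMat p n =
      Matrix.fromBlocks A 0 (B * wMat p n - wMat p n * A) B := by
  have hinv : (uMat p n)⁻¹ = Matrix.fromBlocks 1 0 (-wMat p n) 1 := by
    apply Matrix.inv_eq_left_inv
    simp [uMat, Matrix.fromBlocks_multiply, ← Matrix.fromBlocks_one]
  rw [hinv]
  simp [uMat, blockDiag, Matrix.fromBlocks_multiply, sub_eq_add_neg, add_comm]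

theorem low_apply (p n : ℕ) [Fact p.Prime] (A B : Matrix (Fin n) (Fin n) ℤ_[p]) (i j : Fin n) :
    (B * wMat p n - wMat p n * A) i j = B i j.rev - A i.rev j := by
  have h : ∀ k : Fin n, (j = k.rev) ↔ (k = j.rev) := fun k => by
    rw [eq_comm, Fin.rev_eq_iff]
  simp [Matrix.mul_apply, wMat_apply_rev, h]

/-- For `A, B ∈ GL_n(ℤ_p)`: `u⁻¹·diag(A,B)·u` is upper
triangular mod `p^t` iff there are units `y_1, …, y_n ∈ ℤ_p^×` with
`A ≡ diag(y_1,…,y_n)` and `B ≡ diag(y_n,…,y_1)` mod `p^t`. -/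
theorem stmt9 (p : ℕ) [Fact p.Prime] (n t : ℕ) (hn : 1 ≤ n) (ht : 1 ≤ t)
    (A B : GL (Fin n) ℤ_[p]) :
    (∀ i j : Fin n ⊕ Fin n, ordIdx n j < ordIdx n i →
      (p : ℤ_[p]) ^ t ∣
        ((uMat p n)⁻¹ *
          blockDiag p n (A : Matrix (Fin n) (Fin n) ℤ_[p]) (B : Matrix (Fin n) (Fin n) ℤ_[p]) *
          uMat p n) i j) ↔
    (∃ y : Fin n → ℤ_[p]ˣ,
      (∀ i j : Fin n, (p : ℤ_[p]) ^ t ∣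
        ((A : Matrix (Fin n) (Fin n) ℤ_[p]) i j
          - Matrix.diagonal (fun k => (y k : ℤ_[p])) i j)) ∧
      (∀ i j : Fin n, (p : ℤ_[p]) ^ t ∣
        ((B : Matrix (Fin n) (Fin n) ℤ_[p]) i j
          - Matrix.diagonal (fun k => (y k.rev : ℤ_[p])) i j))) := by
  rw [conj_eq]
  constructor
  · intro h
    have hA : ∀ i j : Fin n, j < i → (p : ℤ_[p]) ^ t ∣ A.val i j := fun i j hij => by
      simpa using h (Sum.inl i) (Sum.inl j) (by simpa [ordIdx] using hij)
    have hB : ∀ i j : Fin n, j < i → (p : ℤ_[p]) ^ t ∣ B.val i j := fun i j hij => by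
      simpa using h (Sum.inr i) (Sum.inr j) (by simpa [ordIdx] using hij)
    have hC : ∀ i j : Fin n, (p : ℤ_[p]) ^ t ∣ B.val i j - A.val i.rev j.rev := fun i j => by
      have := h (Sum.inr i) (Sum.inl j.rev)
        (by simp only [ordIdx, Sum.elim_inl, Sum.elim_inr]; omega)
      rw [Matrix.fromBlocks_apply₂₁, low_apply, Fin.rev_rev] at this
      exact this
    have hA' : ∀ i j : Fin n, i ≠ j → (p : ℤ_[p]) ^ t ∣ A.val i j := fun i j hij => by
      rcases lt_or_gt_of_ne hij with h1 | h1
      · have h2 := hC i.rev j.rev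
        have h3 := hB i.rev j.rev (Fin.rev_lt_rev.mpr h1)
        rw [Fin.rev_rev, Fin.rev_rev] at h2
        exact (dvd_sub_right h3).mp h2
      · exact hA i j h1
    have hu : ∀ i : Fin n, IsUnit (A.val i i) := fun i => by
      by_contra hne
      have hp : (p : ℤ_[p]) ∣ A.val i i := by
        rw [← PadicInt.norm_lt_one_iff_dvd]
        exact PadicInt.not_isUnit_iff.mp hne
      have hrow : ∀ j, (p : ℤ_[p]) ∣ A.val i j := fun j => by
        by_cases hij : i = j
        · exact hij ▸ hp
        · exact (dvd_pow_self _ (by omega)).trans (hA' i j hij)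
      have h1 : (A.val * A.inv) i i = 1 := by rw [A.val_inv]; simp
      have h2 : (p : ℤ_[p]) ∣ 1 := by
        rw [← h1, Matrix.mul_apply]
        exact Finset.dvd_sum fun j _ => (hrow j).mul_right _
      exact PadicInt.prime_p.not_unit (isUnit_of_dvd_one h2)
    have key : ∀ i j : Fin n, (p : ℤ_[p]) ^ t ∣
        A.val i j - Matrix.diagonal (fun k => (((hu k).unit : ℤ_[p]ˣ) : ℤ_[p])) i j := fun i j => by
      by_cases hij : i = j
      · subst hij; simp
      · simpa [Matrix.diagonal_apply_ne _ hij] using hA' i j hij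
    refine ⟨fun k => (hu k).unit, key, fun i j => ?_⟩
    have := dvd_add (hC i j) (key i.rev j.rev)
    rw [sub_add_sub_cancel] at this
    simpa [Matrix.diagonal_apply] using this
  · rintro ⟨y, hA, hB⟩ i j hij
    rcases i with i | i <;> rcases j with j | j
    · have hne : i ≠ j := by rintro rfl; exact lt_irrefl _ hij
      simpa [Matrix.diagonal_apply_ne _ hne] using hA i j
    · simp
    · rw [Matrix.fromBlocks_apply₂₁, low_apply]
      have := dvd_sub (hB i j.rev) (hA i.rev j)
      have e : Matrix.diagonal (fun k => (y k.rev : ℤ_[p])) i j.rev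
          = Matrix.diagonal (fun k => (y k : ℤ_[p])) i.rev j := by
        simp only [Matrix.diagonal_apply, Fin.rev_eq_iff]
      rw [e, sub_sub_sub_cancel_right] at this
      exact this
    · have hne : i ≠ j := by rintro rfl; exact lt_irrefl _ hij
      simpa [Matrix.diagonal_apply_ne _ hne] using hB i j
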